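/- Let n ≥ 1, s ∈ (0,1), 1 < p⁻ ≤ p⁺ < ∞ with s·p⁺ < n, let Ω ⊂ ℝⁿ be open and bounded, and let G be a Young function satisfying condition (cond) with exponents p⁻, p⁺. Then there exists a constant C > 0 (depending on n, s, G and Ω) such that for every measurable u:ℝⁿ→ℝ with ‖u‖_{s,G} := ‖u‖_{L^G(Ω)} + [u]_{s,G} < ∞ one has ‖u‖_{L^{G*}(Ω)} ≤ C·‖u‖_{s,G}. -/

import Mathlib

open MeasureTheory Real Set Filter
open scoped ENNReal

noncomputable section

/-- A Young function `G` together with its right-continuous density `g`: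
`G t = ∫₀ᵗ g(τ) dτ` for `t ≥ 0`, where `g` is right-continuous, nondecreasing on `[0,∞)`,
`g 0 = 0`, `g t > 0` for `t > 0` and `g t → ∞` as `t → ∞`.  `G` is extended evenly
(`G (-t) = G t`) and `g` oddly (`g (-t) = -g t`). -/
structure YoungPair where
  g : ℝ → ℝ
  G : ℝ → ℝ
  g_odd : ∀ t, g (-t) = -g t
  g_zero : g 0 = 0
  g_pos : ∀ t : ℝ, 0 < t → 0 < g t
  g_mono : MonotoneOn g (Set.Ici 0)
  g_rightCont : ∀ t ∈ Set.Ici (0 : ℝ), ContinuousWithinAt g (Set.Ici t) t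
  g_atTop : Filter.Tendsto g Filter.atTop Filter.atTop
  G_even : ∀ t, G (-t) = G t
  G_eq : ∀ t : ℝ, 0 ≤ t → G t = ∫ τ in (0 : ℝ)..t, g τ

/-- Condition (cond): `p⁻ ≤ t·g(t)/G(t) ≤ p⁺` for all `t > 0`. -/
def YoungPair.Cond (Y : YoungPair) (pm pp : ℝ) : Prop :=
  ∀ t : ℝ, 0 < t → pm * Y.G t ≤ t * Y.g t ∧ t * Y.g t ≤ pp * Y.G t

/-- Euclidean space `ℝⁿ`. -/
abbrev Euc (n : ℕ) := EuclideanSpace ℝ (Fin n)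

/-- The `s`-Hölder quotient `D_s u(x,y) = (u x - u y)/|x-y|^s`. -/
def Ds (n : ℕ) (s : ℝ) (u : Euc n → ℝ) (x y : Euc n) : ℝ :=
  (u x - u y) / ‖x - y‖ ^ s

/-- The modular `Φ_G(u) = ∫_Ω G(|u|) dx` (as an extended real). -/
def modG (n : ℕ) (G : ℝ → ℝ) (Ω : Set (Euc n)) (u : Euc n → ℝ) : ℝ≥0∞ :=
  ∫⁻ x in Ω, ENNReal.ofReal (G |u x|)

/-- The Gagliardo modular `Φ_{s,G}(u) = ∬ G(|D_s u(x,y)|) dx dy/|x-y|ⁿ`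
(as an extended real). -/
def modsG (n : ℕ) (s : ℝ) (G : ℝ → ℝ) (u : Euc n → ℝ) : ℝ≥0∞ :=
  ∫⁻ p : Euc n × Euc n, ENNReal.ofReal (G |Ds n s u p.1 p.2| / ‖p.1 - p.2‖ ^ (n : ℝ))

/-- Membership in `W^{s,G}_0(Ω)`: measurable, finite modulars, vanishing a.e. outside `Ω`. -/
def MemW0 (n : ℕ) (s : ℝ) (G : ℝ → ℝ) (Ω : Set (Euc n)) (u : Euc n → ℝ) : Prop :=
  Measurable u ∧ modG n G Ω u + modsG n s G u < ⊤ ∧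
    ∀ᵐ x : Euc n ∂volume, x ∉ Ω → u x = 0

/-- `u` is a weak solution of `(-Δ_g)^s u = rhs(u)` in `Ω`, `u = 0` in `ℝⁿ ∖ Ω`:
for every `v ∈ W^{s,G}_0(Ω)` the defining double integral converges absolutely and equals
`∫_Ω rhs(u) v dx`. -/
def IsWeakSol (n : ℕ) (s : ℝ) (Y : YoungPair) (Ω : Set (Euc n)) (rhs : ℝ → ℝ)
    (u : Euc n → ℝ) : Prop :=
  MemW0 n s Y.G Ω u ∧
  ∀ v : Euc n → ℝ, MemW0 n s Y.G Ω v →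
    MeasureTheory.Integrable (fun p : Euc n × Euc n =>
      Y.g (Ds n s u p.1 p.2) * (v p.1 - v p.2) / ‖p.1 - p.2‖ ^ ((n : ℝ) + s)) ∧
    (∫ p : Euc n × Euc n,
        Y.g (Ds n s u p.1 p.2) * (v p.1 - v p.2) / ‖p.1 - p.2‖ ^ ((n : ℝ) + s)) =
      ∫ x in Ω, rhs (u x) * v x

/-- The Luxemburg norm `‖u‖_{L^Ψ(Ω)}` (with value `∞` when no admissible `λ` exists). -/
def luxNorm (n : ℕ) (Ψ : ℝ → ℝ) (Ω : Set (Euc n)) (u : Euc n → ℝ) : ℝ≥0∞ :=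
  sInf {lam : ℝ≥0∞ | 0 < lam ∧ lam ≠ ⊤ ∧
    (∫⁻ x in Ω, ENNReal.ofReal (Ψ (|u x| / lam.toReal))) ≤ 1}

/-- The Gagliardo seminorm `[u]_{s,G}` (with value `∞` when no admissible `λ` exists). -/
def gagSemi (n : ℕ) (s : ℝ) (G : ℝ → ℝ) (u : Euc n → ℝ) : ℝ≥0∞ :=
  sInf {lam : ℝ≥0∞ | 0 < lam ∧ lam ≠ ⊤ ∧
    modsG n s G (fun x => u x / lam.toReal) ≤ 1}


namespace YoungPair

variable (Y : YoungPair)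

lemma g_nonneg {t : ℝ} (ht : 0 ≤ t) : 0 ≤ Y.g t := by
  rcases ht.eq_or_lt with rfl | h
  · exact Y.g_zero.ge
  · exact (Y.g_pos t h).le

lemma g_intervalIntegrable {a b : ℝ} (ha : 0 ≤ a) (hb : 0 ≤ b) :
    IntervalIntegrable Y.g volume a b := by
  refine MonotoneOn.intervalIntegrable (Y.g_mono.mono fun x hx => ?_)
  exact le_trans (le_min ha hb) hx.1

lemma G_zero : Y.G 0 = 0 := by
  rw [Y.G_eq 0 le_rfl, intervalIntegral.integral_same]

lemma G_monotoneOn : MonotoneOn Y.G (Ici 0) := by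
  intro a ha b hb hab
  rw [Y.G_eq a ha, Y.G_eq b hb]
  refine intervalIntegral.integral_mono_interval le_rfl ha hab ?_
    (Y.g_intervalIntegrable le_rfl hb)
  filter_upwards [ae_restrict_mem measurableSet_Ioc] with x hx
  exact Y.g_nonneg hx.1.le

lemma G_nonneg {t : ℝ} (ht : 0 ≤ t) : 0 ≤ Y.G t :=
  Y.G_zero ▸ Y.G_monotoneOn self_mem_Ici ht ht

lemma G_mul_le {a y : ℝ} (ha : 0 ≤ a) (ha1 : a ≤ 1) (hy : 0 ≤ y) :
    Y.G (a * y) ≤ a * Y.G y := by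
  rw [Y.G_eq _ (mul_nonneg ha hy), Y.G_eq y hy]
  have h := intervalIntegral.mul_integral_comp_mul_left (a := 0) (b := y) (f := Y.g) a
  rw [mul_zero] at h
  rw [← h]
  refine mul_le_mul_of_nonneg_left ?_ ha
  refine intervalIntegral.integral_mono_on hy ?_ (Y.g_intervalIntegrable le_rfl hy) ?_
  · refine MonotoneOn.intervalIntegrable ?_
    intro x hx z hz hxz
    rw [uIcc_of_le hy] at hx hz
    exact Y.g_mono (mul_nonneg ha hx.1) (mul_nonneg ha hz.1)
      (mul_le_mul_of_nonneg_left hxz ha)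
  · intro x hx
    exact Y.g_mono (mul_nonneg ha hx.1) hx.1 (mul_le_of_le_one_left hx.1 ha1)

lemma G_hasDerivWithinAt {t : ℝ} (ht : 0 < t) :
    HasDerivWithinAt Y.G (Y.g t) (Ici t) t := by
  have hint : IntervalIntegrable Y.g volume 0 t := Y.g_intervalIntegrable le_rfl ht.le
  have hm : StronglyMeasurableAtFilter Y.g (nhdsWithin t (Ioi t)) volume := by
    refine ⟨Ioi t, self_mem_nhdsWithin, ?_⟩
    refine (aemeasurable_restrict_of_monotoneOn measurableSet_Ioi
      (Y.g_mono.mono fun x hx => ?_)).aestronglyMeasurable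
    exact ht.le.trans (le_of_lt hx)
  have h := intervalIntegral.integral_hasDerivWithinAt_right (s := Ici t) (t := Ioi t) hint hm
    ((Y.g_rightCont t ht.le).mono Ioi_subset_Ici_self)
  exact h.congr (fun x hx => Y.G_eq x (ht.le.trans hx)) (Y.G_eq t ht.le)

lemma G_continuousOn : ContinuousOn Y.G (Ioi 0) := by
  intro t ht
  have ht : 0 < t := ht
  have h : ContinuousOn (fun x => ∫ τ in (0 : ℝ)..x, Y.g τ) (uIcc 0 (t + 1)) :=
    intervalIntegral.continuousOn_primitive_interval
      ((intervalIntegrable_iff' (by finiteness)).1 (Y.g_intervalIntegrable le_rfl (by linarith)))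
  have h2 : ContinuousAt (fun x => ∫ τ in (0 : ℝ)..x, Y.g τ) t := by
    refine h.continuousAt ?_
    rw [uIcc_of_le (by linarith)]
    exact Icc_mem_nhds ht (by linarith)
  refine (h2.congr ?_).continuousWithinAt
  filter_upwards [Ioi_mem_nhds ht] with x hx
  exact (Y.G_eq x (le_of_lt hx)).symm

lemma rpow_mul_G_le {pm pp : ℝ} (hY : Y.Cond pm pp) {a y : ℝ} (ha : 0 < a) (ha1 : a ≤ 1)
    (hy : 0 ≤ y) : a ^ pp * Y.G y ≤ Y.G (a * y) := by
  rcases hy.eq_or_lt with rfl | hy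
  · simp [Y.G_zero]
  have hay : 0 < a * y := mul_pos ha hy
  have key : Y.G y * y ^ (-pp) ≤ Y.G (a * y) * (a * y) ^ (-pp) := by
    refine image_le_of_deriv_right_le_deriv_boundary (a := a * y) (b := y)
      (f := fun t => Y.G t * t ^ (-pp))
      (f' := fun t => Y.g t * t ^ (-pp) + Y.G t * (-pp * t ^ (-pp - 1)))
      (B := fun _ => Y.G (a * y) * (a * y) ^ (-pp)) (B' := fun _ => 0)
      ?_ ?_ le_rfl continuousOn_const (fun x _ => hasDerivWithinAt_const _ _ _) ?_
      ⟨mul_le_of_le_one_left hy.le ha1, le_rfl⟩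
    · refine (Y.G_continuousOn.mono fun x hx => hay.trans_le hx.1).mul ?_
      intro x hx
      exact (continuousAt_rpow_const x _ (Or.inl (hay.trans_le hx.1).ne')).continuousWithinAt
    · intro x hx
      have hx0 : 0 < x := hay.trans_le hx.1
      exact (Y.G_hasDerivWithinAt hx0).mul
        (hasDerivAt_rpow_const (Or.inl hx0.ne')).hasDerivWithinAt
    · intro x hx
      have hx0 : 0 < x := hay.trans_le hx.1
      have h1 := (hY x hx0).2
      have h2 : x ^ (-pp) = x * x ^ (-pp - 1) := by
        rw [rpow_sub_one hx0.ne']; field_simp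
      rw [h2]
      have h3 : 0 < x ^ (-pp - 1) := rpow_pos_of_pos hx0 _
      nlinarith
  rw [mul_rpow ha.le hy.le, rpow_neg ha.le, rpow_neg hy.le] at key
  have h1 : 0 < a ^ pp := rpow_pos_of_pos ha _
  have h2 : 0 < y ^ pp := rpow_pos_of_pos hy _
  have h3 : Y.G (a * y) * ((a ^ pp)⁻¹ * (y ^ pp)⁻¹) = (Y.G (a * y) / a ^ pp) * (y ^ pp)⁻¹ := by
    field_simp
  rw [h3] at key
  have h4 := le_of_mul_le_mul_right key (inv_pos.2 h2)
  rw [le_div_iff₀ h1] at h4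
  linarith

variable {Y} {Ginv : ℝ → ℝ}

lemma inv_monotoneOn (hGinv : ∀ t : ℝ, 0 ≤ t → 0 ≤ Ginv t ∧ Y.G (Ginv t) = t) :
    MonotoneOn Ginv (Ici 0) := by
  intro a ha b hb hab
  by_contra! h
  have h1 := Y.G_monotoneOn (hGinv b hb).1 (hGinv a ha).1 h.le
  rw [(hGinv a ha).2, (hGinv b hb).2] at h1
  have : a = b := le_antisymm hab h1
  subst this
  exact lt_irrefl _ h

lemma le_inv (hGinv : ∀ t : ℝ, 0 ≤ t → 0 ≤ Ginv t ∧ Y.G (Ginv t) = t)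
    (hGinv' : ∀ t : ℝ, 0 ≤ t → Ginv (Y.G t) = t) {y t : ℝ} (hy : 0 ≤ y)
    (h : Y.G y ≤ t) : y ≤ Ginv t := by
  rw [← hGinv' y hy]
  exact inv_monotoneOn hGinv (Y.G_nonneg hy) ((Y.G_nonneg hy).trans h) h

lemma mul_inv_le (hGinv : ∀ t : ℝ, 0 ≤ t → 0 ≤ Ginv t ∧ Y.G (Ginv t) = t)
    (hGinv' : ∀ t : ℝ, 0 ≤ t → Ginv (Y.G t) = t) {a t : ℝ} (ha : 0 ≤ a) (ha1 : a ≤ 1)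
    (ht : 0 ≤ t) : a * Ginv t ≤ Ginv (a * t) := by
  refine le_inv hGinv hGinv' (mul_nonneg ha (hGinv t ht).1) ?_
  refine (Y.G_mul_le ha ha1 (hGinv t ht).1).trans_eq ?_
  rw [(hGinv t ht).2]

lemma rpow_mul_inv_le {pm pp : ℝ} (hY : Y.Cond pm pp) (hpp : 0 < pp)
    (hGinv : ∀ t : ℝ, 0 ≤ t → 0 ≤ Ginv t ∧ Y.G (Ginv t) = t)
    (hGinv' : ∀ t : ℝ, 0 ≤ t → Ginv (Y.G t) = t) {K t : ℝ} (hK : 1 ≤ K)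
    (ht : 0 ≤ t) : K ^ (1 / pp) * Ginv t ≤ Ginv (K * t) := by
  have hK0 : 0 < K := by linarith
  have hk : 0 < K ^ (1 / pp) := rpow_pos_of_pos hK0 _
  have hk1 : 1 ≤ K ^ (1 / pp) := one_le_rpow hK (by positivity)
  refine le_inv hGinv hGinv' (mul_nonneg hk.le (hGinv t ht).1) ?_
  have h := Y.rpow_mul_G_le hY (a := (K ^ (1 / pp))⁻¹) (y := K ^ (1 / pp) * Ginv t)
    (inv_pos.2 hk) (inv_le_one_of_one_le₀ hk1) (mul_nonneg hk.le (hGinv t ht).1)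
  rw [inv_mul_cancel_left₀ hk.ne', (hGinv t ht).2, inv_rpow hk.le, ← rpow_mul hK0.le,
    one_div_mul_cancel hpp.ne', rpow_one, inv_mul_le_iff₀ hK0] at h
  exact h

end YoungPair

/-- The properties of the critical Young function `H` relative to the inverse `Ginv`
which are used in the proof of the embedding. -/
structure IsCritical (Ginv H : ℝ → ℝ) (θ : ℝ) : Prop where
  nonneg : ∀ t, 0 ≤ t → 0 ≤ H t
  monotoneOn : MonotoneOn H (Ici 0)
  inv_mul_rpow_le : ∀ t, 0 ≤ t → Ginv (H t) * H t ^ (-θ) ≤ t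
  doubling : ∃ K : ℝ, 0 < K ∧ ∀ t, 0 ≤ t → H t ≤ K * H (t / 2)
  small : ∀ ε : ℝ, 0 < ε → ∃ δ : ℝ, 0 < δ ∧ H δ ≤ ε
  pos : ∀ t, 0 < t → 0 < H t

lemma isCritical_of_inverse (θ : ℝ) (hθ : 0 < θ) {pm pp : ℝ} (hpp : 0 < pp) (hθpp : θ * pp < 1)
    (Y : YoungPair) (hY : Y.Cond pm pp) {Ginv Gstar : ℝ → ℝ}
    (hGinv : ∀ t : ℝ, 0 ≤ t → 0 ≤ Ginv t ∧ Y.G (Ginv t) = t)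
    (hGinv' : ∀ t : ℝ, 0 ≤ t → Ginv (Y.G t) = t)
    (hGstar : ∀ r : ℝ, 0 ≤ r → Gstar (∫ τ in (0 : ℝ)..r, Ginv τ * τ ^ (-1 - θ)) = r)
    (hGstar' : ∀ t : ℝ, 0 ≤ t → 0 ≤ Gstar t ∧
      (∫ τ in (0 : ℝ)..(Gstar t), Ginv τ * τ ^ (-1 - θ)) = t) :
    IsCritical Ginv Gstar θ := by
  set f : ℝ → ℝ := fun τ => Ginv τ * τ ^ (-1 - θ) with hf
  have hf0 : ∀ τ, 0 ≤ τ → 0 ≤ f τ := fun τ hτ =>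
    mul_nonneg (hGinv τ hτ).1 (rpow_nonneg hτ _)
  have hfi : ∀ r, 0 ≤ r → IntervalIntegrable f volume 0 r := by
    intro r hr
    by_contra h
    have h1 := hGstar r hr
    have h2 := hGstar 0 le_rfl
    rw [intervalIntegral.integral_undef h] at h1
    rw [intervalIntegral.integral_same] at h2
    have h3 : r = 0 := h1.symm.trans h2
    subst h3
    exact h IntervalIntegrable.refl
  have hφ : ∀ a b, 0 ≤ a → a ≤ b → (∫ τ in (0 : ℝ)..a, f τ) ≤ ∫ τ in (0 : ℝ)..b, f τ := by
    intro a b ha hab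
    refine intervalIntegral.integral_mono_interval le_rfl ha hab ?_ (hfi b (ha.trans hab))
    filter_upwards [ae_restrict_mem measurableSet_Ioc] with x hx
    exact hf0 x hx.1.le
  have hφ0 : ∀ r, 0 ≤ r → 0 ≤ ∫ τ in (0 : ℝ)..r, f τ := fun r hr => by
    simpa using hφ 0 r le_rfl hr
  have hle : ∀ t r, 0 ≤ t → 0 ≤ r → (t ≤ ∫ τ in (0 : ℝ)..r, f τ) → Gstar t ≤ r := by
    intro t r ht hr h
    by_contra! hlt
    have h1 := hφ r (Gstar t) hr hlt.le
    rw [(hGstar' t ht).2] at h1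
    have h2 := hGstar r hr
    rw [← le_antisymm h h1] at h2
    exact hlt.ne' h2
  refine ⟨fun t ht => (hGstar' t ht).1, ?_, ?_, ?_, ?_, ?_⟩
  · intro a ha b hb hab
    refine hle a (Gstar b) ha (hGstar' b hb).1 ?_
    rwa [(hGstar' b hb).2]
  · intro t ht
    obtain ⟨hr, hrt⟩ := hGstar' t ht
    set r := Gstar t
    rcases hr.eq_or_lt with h0 | hr0
    · rw [← h0, zero_rpow (by linarith), mul_zero]
      exact ht
    · rw [← hrt]
      have h1 : (∫ _ in (0 : ℝ)..r, Ginv r / r * r ^ (-θ)) = Ginv r * r ^ (-θ) := by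
        rw [intervalIntegral.integral_const, smul_eq_mul]
        field_simp
        ring
      rw [← h1]
      refine intervalIntegral.integral_mono_on_of_le_Ioo hr intervalIntegrable_const (hfi r hr) ?_
      intro x hx
      have h2 := YoungPair.mul_inv_le hGinv hGinv' (a := x / r) (t := r)
        (div_nonneg hx.1.le hr) ((div_le_one hr0).2 hx.2.le) hr
      rw [div_mul_cancel₀ _ hr0.ne'] at h2
      have h3 : r ^ (-θ) ≤ x ^ (-θ) := rpow_le_rpow_of_nonpos hx.1 hx.2.le (by linarith)
      have h4 : x ^ (-1 - θ) = x ^ (-θ) / x := by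
        rw [← rpow_sub_one hx.1.ne']; congr 1; ring
      have h5 : Ginv r / r ≤ Ginv x / x := by
        rw [le_div_iff₀ hx.1]
        calc Ginv r / r * x = x / r * Ginv r := by ring
          _ ≤ _ := h2
      calc Ginv r / r * r ^ (-θ) ≤ Ginv x / x * x ^ (-θ) :=
            mul_le_mul h5 h3 (rpow_nonneg hr _) (div_nonneg (hGinv x hx.1.le).1 hx.1.le)
        _ = f x := by rw [hf]; simp only [h4]; ring
  · have hγ : 0 < 1 / pp - θ := by
      rw [sub_pos, lt_div_iff₀ hpp]; exact hθpp
    set K : ℝ := 2 ^ (1 / (1 / pp - θ)) with hK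
    have hK1 : 1 ≤ K := one_le_rpow (by norm_num) (by positivity)
    have hK0 : 0 < K := by linarith
    have hK2 : K ^ (1 / pp - θ) = 2 := by
      rw [hK, ← rpow_mul (by norm_num), one_div_mul_cancel hγ.ne', rpow_one]
    refine ⟨K, hK0, fun t ht => ?_⟩
    obtain ⟨hr, hrt⟩ := hGstar' (t / 2) (by linarith)
    set r := Gstar (t / 2)
    refine hle t (K * r) ht (by positivity) ?_
    have hint : IntervalIntegrable (fun τ => K * f (K * τ)) volume 0 r := by
      have := (hfi (K * r) (by positivity)).comp_mul_left (c := K)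
      rw [zero_div, mul_div_cancel_left₀ _ hK0.ne'] at this
      exact this.const_mul K
    have h := intervalIntegral.mul_integral_comp_mul_left (a := 0) (b := r) (f := f) K
    rw [mul_zero] at h
    rw [← h, ← intervalIntegral.integral_const_mul]
    have h1 : t = ∫ τ in (0 : ℝ)..r, 2 * f τ := by
      rw [intervalIntegral.integral_const_mul, hrt]; ring
    rw [h1]
    refine intervalIntegral.integral_mono_on_of_le_Ioo hr ((hfi r hr).const_mul 2) hint ?_
    intro x hx
    have h2 := YoungPair.rpow_mul_inv_le hY hpp hGinv hGinv' hK1 hx.1.le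
    have h3 : K * K ^ (-1 - θ) = K ^ (-θ) := by
      rw [← rpow_one_add' hK0.le (by linarith)]; congr 1; ring
    have h4 : K ^ (1 / pp) * K ^ (-θ) = 2 := by
      rw [← rpow_add hK0, ← sub_eq_add_neg, hK2]
    have h5 : 0 ≤ K ^ (-θ) * x ^ (-1 - θ) :=
      mul_nonneg (rpow_nonneg hK0.le _) (rpow_nonneg hx.1.le _)
    calc 2 * f x = (K ^ (1 / pp) * Ginv x) * (K ^ (-θ) * x ^ (-1 - θ)) := by
          rw [← h4, hf]; ring
      _ ≤ Ginv (K * x) * (K ^ (-θ) * x ^ (-1 - θ)) := mul_le_mul_of_nonneg_right h2 h5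
      _ = K * f (K * x) := by
          rw [← h3, hf]; simp only [mul_rpow hK0.le hx.1.le]; ring
  · intro ε hε
    refine ⟨∫ τ in (0 : ℝ)..ε, f τ, ?_, (hGstar ε hε.le).le⟩
    refine (hφ0 ε hε.le).lt_of_ne fun h => ?_
    have h1 := hGstar ε hε.le
    have h2 := hGstar 0 le_rfl
    rw [intervalIntegral.integral_same] at h2
    rw [← h, h2] at h1
    exact hε.ne h1
  · intro t ht
    obtain ⟨hr, hrt⟩ := hGstar' t ht.le
    refine hr.lt_of_ne fun h => ?_
    rw [← h, intervalIntegral.integral_same] at hrt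
    exact ht.ne hrt

/-- The inner integral of the Gagliardo modular at the point `x`. -/
def gagInner (n : ℕ) (s : ℝ) (G : ℝ → ℝ) (w : Euc n → ℝ) (x : Euc n) : ℝ≥0∞ :=
  ∫⁻ y, ENNReal.ofReal (G |Ds n s w x y| / ‖x - y‖ ^ (n : ℝ))

lemma measurable_comp_of_monotoneOn {α : Type*} [MeasurableSpace α] {H : ℝ → ℝ}
    (hH : MonotoneOn H (Ici 0)) {f : α → ℝ} (hf : Measurable f) (hf0 : ∀ x, 0 ≤ f x) :
    Measurable fun x => H (f x) := by
  have h : Monotone fun t => H (max t 0) := fun a b hab =>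
    hH (mem_Ici.2 (le_max_right _ _)) (mem_Ici.2 (le_max_right _ _)) (max_le_max_right 0 hab)
  have h2 := h.measurable.comp hf
  simpa only [Function.comp_def, max_eq_left (hf0 _)] using h2

lemma measurable_gagliardo_integrand (n : ℕ) (s : ℝ) (Y : YoungPair) {w : Euc n → ℝ}
    (hw : Measurable w) :
    Measurable fun p : Euc n × Euc n =>
      ENNReal.ofReal (Y.G |Ds n s w p.1 p.2| / ‖p.1 - p.2‖ ^ (n : ℝ)) := by
  have h1 : Measurable fun p : Euc n × Euc n => |Ds n s w p.1 p.2| := by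
    unfold Ds
    fun_prop
  have h2 := measurable_comp_of_monotoneOn Y.G_monotoneOn h1 fun p => abs_nonneg _
  exact (h2.div (by fun_prop)).ennreal_ofReal

lemma lintegral_gagInner (n : ℕ) (s : ℝ) (Y : YoungPair) {w : Euc n → ℝ}
    (hw : Measurable w) : ∫⁻ x, gagInner n s Y.G w x = modsG n s Y.G w := by
  unfold gagInner modsG
  rw [Measure.volume_eq_prod,
    lintegral_prod _ (measurable_gagliardo_integrand n s Y hw).aemeasurable]

lemma measurable_gagInner (n : ℕ) (s : ℝ) (Y : YoungPair) {w : Euc n → ℝ}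
    (hw : Measurable w) : Measurable (gagInner n s Y.G w) :=
  (measurable_gagliardo_integrand n s Y hw).lintegral_prod_right'

lemma mul_volume_le_gagInner (n : ℕ) {s : ℝ} (hs : 0 < s) (Y : YoungPair) {w : Euc n → ℝ}
    {x : Euc n} {E : Set (Euc n)} (hE : MeasurableSet E) {r t : ℝ} (ht : 0 < t)
    (hEr : ∀ y ∈ E, ‖x - y‖ ≤ r ∧ w y ≤ t) (hx : 2 * t ≤ w x) :
    ENNReal.ofReal (Y.G (t / r ^ s) / r ^ (n : ℝ)) * volume E ≤ gagInner n s Y.G w x := by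
  unfold gagInner
  rw [← setLIntegral_const]
  refine le_trans (setLIntegral_mono' hE fun y hy => ?_) (setLIntegral_le_lintegral E _)
  obtain ⟨h1, h2⟩ := hEr y hy
  have hd : 0 < ‖x - y‖ := by
    refine norm_pos_iff.2 fun h => ?_
    rw [sub_eq_zero] at h
    subst h
    linarith
  have hds : 0 < ‖x - y‖ ^ s := rpow_pos_of_pos hd _
  have hr : 0 < r := hd.trans_le h1
  have hrs : 0 < r ^ s := rpow_pos_of_pos hr _
  have hle : t / r ^ s ≤ |Ds n s w x y| := by
    refine le_trans ?_ (le_abs_self _)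
    unfold Ds
    exact div_le_div₀ (by linarith) (by linarith) hds
      (rpow_le_rpow hd.le h1 hs.le)
  refine ENNReal.ofReal_le_ofReal ?_
  have h0 : 0 ≤ t / r ^ s := by positivity
  exact div_le_div₀ (Y.G_nonneg (abs_nonneg _))
    (Y.G_monotoneOn h0 (mem_Ici.2 (abs_nonneg _)) hle) (rpow_pos_of_pos hd _)
    (rpow_le_rpow hd.le h1 (Nat.cast_nonneg n))

lemma le_ofReal_of_mul_le_ofReal {a b : ℝ} (ha : 0 < a) {v : ℝ≥0∞}
    (h : ENNReal.ofReal a * v ≤ ENNReal.ofReal b) : v ≤ ENNReal.ofReal (b / a) := by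
  rw [ENNReal.ofReal_div_of_pos ha, ENNReal.le_div_iff_mul_le
    (Or.inl (ENNReal.ofReal_pos.2 ha).ne') (Or.inl ENNReal.ofReal_ne_top), mul_comm]
  exact h

lemma volume_superlevel_le {n : ℕ} {H : ℝ → ℝ} (hH : MonotoneOn H (Ici 0)) {S : Set (Euc n)}
    (hS : MeasurableSet S) {w : Euc n → ℝ} (hw : Measurable w) {t b : ℝ} (ht : 0 ≤ t)
    (hHt : 0 < H t) (hb : ∫⁻ x in S, ENNReal.ofReal (H (w x)) ≤ ENNReal.ofReal b) :
    volume (S ∩ {x | t < w x}) ≤ ENNReal.ofReal (b / H t) := by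
  refine le_ofReal_of_mul_le_ofReal hHt (le_trans ?_ hb)
  rw [← setLIntegral_const]
  refine le_trans (setLIntegral_mono' (hS.inter (measurableSet_lt measurable_const hw))
    fun x hx => ?_) (lintegral_mono_set inter_subset_left)
  have hx2 : t < w x := hx.2
  exact ENNReal.ofReal_le_ofReal (hH ht (ht.trans hx2.le) hx2.le)

lemma exists_volume_superlevel_le {n : ℕ} {s : ℝ} (hs : 0 < s) (Y : YoungPair) {Ginv : ℝ → ℝ}
    (hGinv : ∀ t : ℝ, 0 ≤ t → 0 ≤ Ginv t ∧ Y.G (Ginv t) = t)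
    {Ω : Set (Euc n)} (hΩ : MeasurableSet Ω) (hΩ0 : volume Ω ≠ 0) {R : ℝ} (hR : 0 < R)
    (hΩR : Ω ⊆ Metric.ball 0 R) {κ : ℝ} (hκ : 0 < κ) :
    ∃ t₀ : ℝ, 0 < t₀ ∧ ∀ w : Euc n → ℝ, Measurable w →
      ∫⁻ x in Ω, ENNReal.ofReal (Y.G (w x)) ≤ 1 → modsG n s Y.G w ≤ 1 →
      volume (Metric.ball (0 : Euc n) R ∩ {x | t₀ < w x}) ≤ ENNReal.ofReal κ := by
  have hΩt : volume Ω ≠ ⊤ := ((measure_mono hΩR).trans_lt measure_ball_lt_top).ne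
  set m : ℝ := (volume Ω).toReal with hm
  have hm0 : 0 < m := ENNReal.toReal_pos hΩ0 hΩt
  have hmv : volume Ω = ENNReal.ofReal m := (ENNReal.ofReal_toReal hΩt).symm
  have h2R : 0 < 2 * R := by linarith
  have hRs : 0 < (2 * R) ^ s := rpow_pos_of_pos h2R _
  have hRn : 0 < (2 * R) ^ (n : ℝ) := rpow_pos_of_pos h2R _
  obtain ⟨ht1, hGt1⟩ := hGinv (2 / m) (by positivity)
  set t₁ := Ginv (2 / m)
  have ht1p : 0 < t₁ := by
    refine ht1.lt_of_ne fun h => ?_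
    rw [← h, Y.G_zero] at hGt1
    exact (div_pos two_pos hm0).ne hGt1
  set b : ℝ := (2 * R) ^ (n : ℝ) * 2 / (m * κ) with hb
  obtain ⟨ht2, hGt2⟩ := hGinv b (by positivity)
  set t : ℝ := max t₁ ((2 * R) ^ s * Ginv b) with ht
  have htp : 0 < t := lt_max_of_lt_left ht1p
  refine ⟨2 * t, by linarith, fun w hw hwΩ hws => ?_⟩
  have hbad : volume (Ω ∩ {x | t₁ < w x}) ≤ ENNReal.ofReal (m / 2) := by
    have := volume_superlevel_le Y.G_monotoneOn hΩ hw ht1 (b := 1)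
      (by rw [hGt1]; positivity) (by simpa using hwΩ)
    rwa [hGt1, one_div_div] at this
  set E : Set (Euc n) := Ω \ {x | t₁ < w x} with hE
  have hEm : MeasurableSet E := hΩ.diff (measurableSet_lt measurable_const hw)
  have hEv : ENNReal.ofReal (m / 2) ≤ volume E := by
    have h1 : volume Ω ≤ volume (Ω ∩ {x | t₁ < w x}) + volume E :=
      measure_le_inter_add_sdiff _ _ _
    have h2 : ENNReal.ofReal (m / 2) + ENNReal.ofReal (m / 2) ≤
        ENNReal.ofReal (m / 2) + volume E := by
      rw [← ENNReal.ofReal_add (by positivity) (by positivity), add_halves, ← hmv]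
      exact h1.trans (by gcongr)
    exact (ENNReal.add_le_add_iff_left ENNReal.ofReal_ne_top).1 h2
  have hbt : b ≤ Y.G (t / (2 * R) ^ s) := by
    rw [← hGt2]
    have : Ginv b ≤ t / (2 * R) ^ s := by
      rw [le_div_iff₀ hRs, mul_comm]
      exact le_max_right _ _
    exact Y.G_monotoneOn ht2 (ht2.trans this) this
  have hpt : ∀ x ∈ Metric.ball (0 : Euc n) R ∩ {x | 2 * t < w x},
      ENNReal.ofReal (1 / κ) ≤ gagInner n s Y.G w x := by
    rintro x ⟨hx, hwx⟩
    have hwx : 2 * t < w x := hwx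
    refine le_trans ?_ (mul_volume_le_gagInner n hs Y hEm (r := 2 * R) htp ?_ hwx.le)
    · refine le_trans ?_ (mul_le_mul_right hEv _)
      rw [← ENNReal.ofReal_mul (div_nonneg (Y.G_nonneg (by positivity)) hRn.le)]
      refine ENNReal.ofReal_le_ofReal ?_
      calc 1 / κ = b / (2 * R) ^ (n : ℝ) * (m / 2) := by rw [hb]; field_simp
        _ ≤ _ := by gcongr
    · intro y hy
      have h1 := mem_ball_zero_iff.1 hx
      have h2 := mem_ball_zero_iff.1 (hΩR hy.1)
      refine ⟨(norm_sub_le x y).trans (by linarith), ?_⟩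
      have h3 : ¬ t₁ < w y := hy.2
      exact (not_lt.1 h3).trans (le_max_left _ _)
  have hfin : ENNReal.ofReal (1 / κ) * volume (Metric.ball (0 : Euc n) R ∩ {x | 2 * t < w x})
      ≤ ENNReal.ofReal 1 := by
    rw [← setLIntegral_const]
    refine (setLIntegral_mono' (measurableSet_ball.inter
      (measurableSet_lt measurable_const hw)) hpt).trans ?_
    refine (setLIntegral_le_lintegral _ _).trans ?_
    rw [lintegral_gagInner n s Y hw, ENNReal.ofReal_one]
    exact hws
  have := le_ofReal_of_mul_le_ofReal (by positivity) hfin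
  rwa [one_div_one_div] at this

lemma volume_ball_eq (n : ℕ) (hn : 1 ≤ n) : ∃ ω : ℝ, 0 < ω ∧ ∀ (x : Euc n) (r : ℝ), 0 ≤ r →
    volume (Metric.ball x r) = ENNReal.ofReal (ω * r ^ (n : ℝ)) := by
  have : Nonempty (Fin n) := ⟨⟨0, hn⟩⟩
  have hfin : volume (Metric.ball (0 : Euc n) 1) ≠ ⊤ := measure_ball_lt_top.ne
  refine ⟨(volume (Metric.ball (0 : Euc n) 1)).toReal,
    ENNReal.toReal_pos (Metric.measure_ball_pos _ _ one_pos).ne' hfin, fun x r hr => ?_⟩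
  rw [Measure.addHaar_ball _ _ hr, ENNReal.ofReal_mul ENNReal.toReal_nonneg,
    ENNReal.ofReal_toReal hfin, mul_comm, finrank_euclideanSpace_fin, rpow_natCast]

lemma ofReal_le_gagInner {n : ℕ} (hn : 1 ≤ n) {s : ℝ} (hs : 0 < s) (Y : YoungPair) {ω : ℝ}
    (hω : 0 < ω) (hball : ∀ (x : Euc n) (r : ℝ), 0 ≤ r →
      volume (Metric.ball x r) = ENNReal.ofReal (ω * r ^ (n : ℝ)))
    {R : ℝ} (hR : 0 < R) {w : Euc n → ℝ} (hw : Measurable w) {x : Euc n}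
    (hx : x ∈ Metric.ball (0 : Euc n) R) {t δ : ℝ} (ht : 0 < t) (hxt : 2 * t ≤ w x) (hδ : 0 < δ)
    (hδR : δ ≤ ω * R ^ (n : ℝ) / 2)
    (hvol : volume (Metric.ball (0 : Euc n) R ∩ {x | t < w x}) ≤ ENNReal.ofReal δ) :
    ENNReal.ofReal (ω / 2 ^ ((n : ℝ) + 1) *
      Y.G (t / ((2 ^ ((n : ℝ) + 1) / ω) ^ (s / n) * δ ^ (s / n)))) ≤ gagInner n s Y.G w x := by
  have hn0 : (0 : ℝ) < n := by exact_mod_cast hn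
  set q : ℝ := 2 ^ ((n : ℝ) + 1) / ω with hq
  have hq0 : 0 < q := by positivity
  have hqn : q = 2 * 2 ^ (n : ℝ) / ω := by
    rw [hq, rpow_add_one two_ne_zero, mul_comm]
  set r : ℝ := (q * δ) ^ (1 / (n : ℝ)) with hr
  have hr0 : 0 < r := by positivity
  have hrn : r ^ (n : ℝ) = q * δ := by
    rw [hr, ← rpow_mul (by positivity), one_div_mul_cancel hn0.ne', rpow_one]
  have hrs : r ^ s = q ^ (s / n) * δ ^ (s / n) := by
    rw [hr, ← rpow_mul (by positivity), one_div_mul_eq_div, mul_rpow hq0.le hδ.le]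
  have h2n : (0 : ℝ) < 2 ^ (n : ℝ) := by positivity
  have hr2 : r / 2 ≤ R := by
    refine (rpow_le_rpow_iff (by positivity) hR.le hn0).1 ?_
    rw [div_rpow hr0.le two_pos.le, hrn, hqn]
    calc 2 * 2 ^ (n : ℝ) / ω * δ / 2 ^ (n : ℝ) = 2 / ω * δ := by field_simp
      _ ≤ 2 / ω * (ω * R ^ (n : ℝ) / 2) := by gcongr
      _ = R ^ (n : ℝ) := by field_simp
  have hvolr : volume (Metric.ball ((1 - r / (2 * R)) • x) (r / 2)) = ENNReal.ofReal (2 * δ) := by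
    rw [hball _ _ (by positivity), div_rpow hr0.le two_pos.le, hrn, hqn]
    congr 1
    field_simp
  have hxR : ‖x‖ < R := mem_ball_zero_iff.1 hx
  have hrR : r / (2 * R) ≤ 1 := by
    rw [div_le_one (by positivity)]; linarith
  have hrx : r / (2 * R) * ‖x‖ ≤ r / 2 := by
    calc r / (2 * R) * ‖x‖ ≤ r / (2 * R) * R := by gcongr
      _ = r / 2 := by field_simp
  set E : Set (Euc n) := Metric.ball ((1 - r / (2 * R)) • x) (r / 2) \
    (Metric.ball (0 : Euc n) R ∩ {x | t < w x}) with hE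
  have hEm : MeasurableSet E := measurableSet_ball.diff
    (measurableSet_ball.inter (measurableSet_lt measurable_const hw))
  have hEv : ENNReal.ofReal δ ≤ volume E := by
    have h1 := le_measure_sdiff (μ := (volume : Measure (Euc n)))
      (s₁ := Metric.ball ((1 - r / (2 * R)) • x) (r / 2))
      (s₂ := Metric.ball (0 : Euc n) R ∩ {x | t < w x})
    refine le_trans ?_ h1
    rw [hvolr]
    refine le_trans ?_ (tsub_le_tsub_left hvol _)
    rw [← ENNReal.ofReal_sub _ hδ.le]
    exact ENNReal.ofReal_le_ofReal (by linarith)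
  have hEr : ∀ y ∈ E, ‖x - y‖ ≤ r ∧ w y ≤ t := by
    rintro y ⟨hy, hy2⟩
    have hyc : ‖y - (1 - r / (2 * R)) • x‖ < r / 2 := mem_ball_iff_norm.1 hy
    constructor
    · have : x - y = (r / (2 * R)) • x - (y - (1 - r / (2 * R)) • x) := by
        rw [sub_smul, one_smul]; abel
      rw [this]
      refine (norm_sub_le _ _).trans ?_
      rw [norm_smul, Real.norm_of_nonneg (by positivity)]
      linarith
    · by_contra! h
      refine hy2 ⟨mem_ball_zero_iff.2 ?_, h⟩
      have : y = (1 - r / (2 * R)) • x + (y - (1 - r / (2 * R)) • x) := by abel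
      rw [this]
      refine (norm_add_le _ _).trans_lt ?_
      rw [norm_smul, Real.norm_of_nonneg (by linarith)]
      have h3 : (1 - r / (2 * R)) * ‖x‖ ≤ (1 - r / (2 * R)) * R :=
        mul_le_mul_of_nonneg_left hxR.le (by linarith)
      have h4 : (1 - r / (2 * R)) * R = R - r / 2 := by field_simp
      linarith
  refine le_trans ?_ (mul_volume_le_gagInner n hs Y hEm ht hEr hxt)
  refine le_trans ?_ (mul_le_mul_right hEv _)
  have hG : 0 ≤ Y.G (t / r ^ s) := Y.G_nonneg (by positivity)
  rw [← ENNReal.ofReal_mul (div_nonneg hG (by positivity)), ← hrs, hrn]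
  refine ENNReal.ofReal_le_ofReal (le_of_eq ?_)
  rw [hq]
  field_simp

lemma critical_le_mul_G {Y : YoungPair} {pm pp : ℝ} (hY : Y.Cond pm pp) {θ : ℝ} (hθ : 0 < θ)
    (hθpp : θ * pp ≤ 1) {Ginv H : ℝ → ℝ}
    (hGinv : ∀ t : ℝ, 0 ≤ t → 0 ≤ Ginv t ∧ Y.G (Ginv t) = t) (hH : IsCritical Ginv H θ)
    {K : ℝ} (hK : 0 < K) (hHK : ∀ t, 0 ≤ t → H t ≤ K * H (t / 2)) {c L Λ : ℝ} (hc : 0 < c)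
    (hL : 1 ≤ L) (hΛ : L * (2 * c * K ^ θ) ≤ Λ) {A t δ : ℝ} (hA : 0 ≤ A) (ht : 0 < t)
    (hδ : 0 < δ) (hδA : δ ≤ (A + 1) / H (t / Λ)) :
    L * H (2 * t / Λ) ≤ (A + 1) * Y.G (t / (c * δ ^ θ)) := by
  have hL0 : 0 < L := by linarith
  have hKθ : 0 < K ^ θ := rpow_pos_of_pos hK _
  have hΛ0 : 0 < Λ := lt_of_lt_of_le (by positivity) hΛ
  have hτ' : 0 < H (t / Λ) := hH.pos _ (by positivity)
  have hτ : 0 < H (2 * t / Λ) := hH.pos _ (by positivity)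
  have hττ' : H (2 * t / Λ) ≤ K * H (t / Λ) := by
    have := hHK (2 * t / Λ) (by positivity)
    rwa [show 2 * t / Λ / 2 = t / Λ by ring] at this
  have hinv := hH.inv_mul_rpow_le (2 * t / Λ) (by positivity)
  obtain ⟨hI0, hI⟩ := hGinv _ hτ.le
  set τ := H (2 * t / Λ)
  set τ' := H (t / Λ)
  have hA1 : 0 < A + 1 := by linarith
  have hδθ : c * δ ^ θ ≤ c * ((A + 1) ^ θ / τ' ^ θ) := by
    rw [← div_rpow hA1.le hτ'.le]
    gcongr
  have hAθ : 0 < (A + 1) ^ θ := rpow_pos_of_pos hA1 _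
  have hτθ : 0 < τ ^ θ := rpow_pos_of_pos hτ _
  have hτθ' : 0 < τ' ^ θ := rpow_pos_of_pos hτ' _
  have hδθ0 : 0 < c * δ ^ θ := by positivity
  have h1 : τ ^ θ ≤ K ^ θ * τ' ^ θ := by
    rw [← mul_rpow hK.le hτ'.le]
    gcongr
  have h2 : Ginv τ * Λ ≤ 2 * t * τ ^ θ := by
    rw [rpow_neg hτ.le, ← div_eq_mul_inv, div_le_div_iff₀ hτθ hΛ0] at hinv
    exact hinv
  have harg : L * (((A + 1) ^ θ)⁻¹ * Ginv τ) ≤ t / (c * δ ^ θ) := by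
    refine le_trans ?_ (div_le_div_of_nonneg_left ht.le hδθ0 hδθ)
    rw [le_div_iff₀ (by positivity)]
    have h3 : L * (((A + 1) ^ θ)⁻¹ * Ginv τ) * (c * ((A + 1) ^ θ / τ' ^ θ)) =
        L * c * Ginv τ / τ' ^ θ := by field_simp
    rw [h3, div_le_iff₀ hτθ']
    have h4 : (L * c * Ginv τ) * (2 * K ^ θ) ≤ (t * τ' ^ θ) * (2 * K ^ θ) := by
      calc (L * c * Ginv τ) * (2 * K ^ θ) = Ginv τ * (L * (2 * c * K ^ θ)) := by ring
        _ ≤ Ginv τ * Λ := by gcongr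
        _ ≤ 2 * t * τ ^ θ := h2
        _ ≤ 2 * t * (K ^ θ * τ' ^ θ) := by gcongr
        _ = _ := by ring
    exact le_of_mul_le_mul_right h4 (by positivity)
  have ha1 : ((A + 1) ^ θ)⁻¹ ≤ 1 := inv_le_one_of_one_le₀ (one_le_rpow (by linarith) hθ.le)
  have hy0 : 0 ≤ ((A + 1) ^ θ)⁻¹ * Ginv τ := by positivity
  have hLy0 : 0 ≤ L * (((A + 1) ^ θ)⁻¹ * Ginv τ) := by positivity
  have hG1 : L * Y.G (((A + 1) ^ θ)⁻¹ * Ginv τ) ≤ Y.G (t / (c * δ ^ θ)) := by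
    have h5 := Y.G_mul_le (a := L⁻¹) (inv_nonneg.2 hL0.le) (inv_le_one_of_one_le₀ hL) hLy0
    rw [inv_mul_cancel_left₀ hL0.ne', le_inv_mul_iff₀ hL0] at h5
    exact h5.trans (Y.G_monotoneOn hLy0 (hLy0.trans harg) harg)
  have hG2 : (A + 1)⁻¹ * τ ≤ Y.G (((A + 1) ^ θ)⁻¹ * Ginv τ) := by
    have h6 := Y.rpow_mul_G_le hY (inv_pos.2 hAθ) ha1 hI0
    rw [hI] at h6
    refine le_trans ?_ h6
    refine mul_le_mul_of_nonneg_right ?_ hτ.le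
    rw [inv_rpow hAθ.le, ← rpow_mul hA1.le]
    refine inv_anti₀ (rpow_pos_of_pos hA1 _) ?_
    calc (A + 1) ^ (θ * pp) ≤ (A + 1) ^ (1 : ℝ) := rpow_le_rpow_of_exponent_le (by linarith) hθpp
      _ = A + 1 := rpow_one _
  calc L * τ = (A + 1) * (L * ((A + 1)⁻¹ * τ)) := by field_simp
    _ ≤ (A + 1) * (L * Y.G (((A + 1) ^ θ)⁻¹ * Ginv τ)) := by gcongr
    _ ≤ _ := by gcongr

lemma exists_modular_le_one_of_bounded {n : ℕ} (hn : 1 ≤ n) {s : ℝ} (hs : 0 < s)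
    {pm pp : ℝ} (hspp : s * pp < n) {Ω : Set (Euc n)} (hΩ : MeasurableSet Ω)
    (hΩ0 : volume Ω ≠ 0) (hΩb : Bornology.IsBounded Ω) {Y : YoungPair} (hY : Y.Cond pm pp)
    {Ginv H : ℝ → ℝ} (hGinv : ∀ t : ℝ, 0 ≤ t → 0 ≤ Ginv t ∧ Y.G (Ginv t) = t)
    (hH : IsCritical Ginv H (s / n)) :
    ∃ Λ : ℝ, 0 < Λ ∧ ∀ w : Euc n → ℝ, Measurable w → (∀ x, 0 ≤ w x) → (∃ M, ∀ x, w x ≤ M) →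
      ∫⁻ x in Ω, ENNReal.ofReal (Y.G (w x)) ≤ 1 → modsG n s Y.G w ≤ 1 →
      ∫⁻ x in Ω, ENNReal.ofReal (H (w x / Λ)) ≤ 1 := by
  have hn0 : (0 : ℝ) < n := by exact_mod_cast hn
  have hθ : 0 < s / n := by positivity
  have hθpp : s / n * pp ≤ 1 := by
    rw [div_mul_eq_mul_div, div_le_one hn0]; exact hspp.le
  obtain ⟨R, hR, hΩR⟩ := hΩb.subset_ball_lt 0 (0 : Euc n)
  obtain ⟨ω, hω, hball⟩ := volume_ball_eq n hn
  obtain ⟨K, hK, hHK⟩ := hH.doubling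
  set V : ℝ := ω * R ^ (n : ℝ) with hV
  have hV0 : 0 < V := by positivity
  have hvB : volume (Metric.ball (0 : Euc n) R) = ENNReal.ofReal V := hball 0 R hR.le
  obtain ⟨t₀, ht₀, htail⟩ := exists_volume_superlevel_le hs Y hGinv hΩ hΩ0 hR hΩR
    (κ := V / 2) (by positivity)
  obtain ⟨d, hd, hHd⟩ := hH.small (1 / (3 * V)) (by positivity)
  set c₁ : ℝ := ω / 2 ^ ((n : ℝ) + 1) with hc₁
  set c₂ : ℝ := (2 ^ ((n : ℝ) + 1) / ω) ^ (s / n) with hc₂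
  have hc₁0 : 0 < c₁ := by positivity
  have hc₂0 : 0 < c₂ := by positivity
  set L : ℝ := max 1 (3 / c₁) with hL
  have hL1 : 1 ≤ L := le_max_left _ _
  have hLc : 3 ≤ c₁ * L := by
    rw [← div_le_iff₀' hc₁0]; exact le_max_right _ _
  set Λ : ℝ := max (L * (2 * c₂ * K ^ (s / n))) (2 * t₀ / d) with hΛ
  have hΛ0 : 0 < Λ := lt_max_of_lt_right (by positivity)
  refine ⟨Λ, hΛ0, fun w hw hw0 ⟨M, hwM⟩ hwΩ hws => ?_⟩
  have hwΛ0 : ∀ x, 0 ≤ w x / Λ := fun x => div_nonneg (hw0 x) hΛ0.le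
  have hHm : Measurable fun x => H (w x / Λ) :=
    measurable_comp_of_monotoneOn hH.monotoneOn (hw.div_const Λ) hwΛ0
  set B : Set (Euc n) := Metric.ball (0 : Euc n) R with hB
  have hBm : MeasurableSet B := measurableSet_ball
  set I : ℝ≥0∞ := ∫⁻ x in B, ENNReal.ofReal (H (w x / Λ)) with hI
  have hIt : I ≠ ⊤ := by
    have h1 : I ≤ ∫⁻ _ in B, ENNReal.ofReal (H (M / Λ)) := by
      refine lintegral_mono fun x => ENNReal.ofReal_le_ofReal ?_
      have h2 : w x / Λ ≤ M / Λ := by gcongr; exact hwM x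
      exact hH.monotoneOn (hwΛ0 x) ((hwΛ0 x).trans h2) h2
    refine (h1.trans_lt ?_).ne
    rw [setLIntegral_const, hvB]
    exact ENNReal.mul_lt_top ENNReal.ofReal_lt_top ENNReal.ofReal_lt_top
  set A : ℝ := I.toReal with hA
  have hA0 : 0 ≤ A := ENNReal.toReal_nonneg
  have hIA : I = ENNReal.ofReal A := (ENNReal.ofReal_toReal hIt).symm
  have hpt : ∀ x ∈ B, ENNReal.ofReal (H (w x / Λ)) ≤
      ENNReal.ofReal (1 / (3 * V)) + ENNReal.ofReal ((A + 1) / 3) * gagInner n s Y.G w x := by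
    intro x hx
    rcases le_or_gt (w x) (2 * t₀) with hle | hgt
    · refine le_trans (ENNReal.ofReal_le_ofReal ?_) le_self_add
      refine le_trans ?_ hHd
      refine hH.monotoneOn (hwΛ0 x) hd.le ?_
      rw [div_le_iff₀ hΛ0]
      have : 2 * t₀ ≤ d * Λ := by
        rw [← div_le_iff₀' hd]; exact le_max_right _ _
      linarith
    · refine le_trans ?_ le_add_self
      set t : ℝ := w x / 2 with ht
      have h2t : 2 * t = w x := by rw [ht]; ring
      have htt : t₀ ≤ t := by linarith
      have ht0 : 0 < t := by linarith
      have hτ' : 0 < H (t / Λ) := hH.pos _ (by positivity)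
      have hv1 : volume (B ∩ {x | t < w x}) ≤ ENNReal.ofReal ((A + 1) / H (t / Λ)) := by
        have h3 := volume_superlevel_le hH.monotoneOn hBm (hw.div_const Λ) (t := t / Λ)
          (b := A + 1) (by positivity) hτ'
          (hIA.le.trans (ENNReal.ofReal_le_ofReal (by linarith)))
        refine le_trans (measure_mono ?_) h3
        rintro y ⟨hy1, hy2⟩
        exact ⟨hy1, div_lt_div_of_pos_right hy2 hΛ0⟩
      have hv2 : volume (B ∩ {x | t < w x}) ≤ ENNReal.ofReal (V / 2) := by
        refine le_trans (measure_mono ?_) (htail w hw hwΩ hws)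
        rintro y ⟨hy1, hy2⟩
        exact ⟨hy1, htt.trans_lt hy2⟩
      set δ : ℝ := min ((A + 1) / H (t / Λ)) (V / 2) with hδ
      have hδ0 : 0 < δ := lt_min (by positivity) (by positivity)
      have hv : volume (B ∩ {x | t < w x}) ≤ ENNReal.ofReal δ := by
        rw [hδ, ENNReal.ofReal_min]
        exact le_min hv1 hv2
      have hF := ofReal_le_gagInner hn hs Y hω hball hR hw hx ht0 h2t.le hδ0
        (min_le_right _ _) hv
      have hreal := critical_le_mul_G hY hθ hθpp hGinv hH hK hHK hc₂0 hL1
        (le_max_left _ (2 * t₀ / d)) hA0 ht0 hδ0 (min_le_left _ _)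
      rw [h2t] at hreal
      refine le_trans ?_ (mul_le_mul_right hF _)
      rw [← ENNReal.ofReal_mul (by positivity)]
      refine ENNReal.ofReal_le_ofReal ?_
      have hτ : 0 ≤ H (w x / Λ) := hH.nonneg _ (hwΛ0 x)
      calc H (w x / Λ) = 3 * H (w x / Λ) / 3 := by ring
        _ ≤ c₁ * L * H (w x / Λ) / 3 := by gcongr
        _ = c₁ * (L * H (w x / Λ)) / 3 := by ring
        _ ≤ c₁ * ((A + 1) * Y.G (t / (c₂ * δ ^ (s / n)))) / 3 := by gcongr
        _ = _ := by ring
  have hIle : I ≤ ENNReal.ofReal (1 / 3 + (A + 1) / 3) := by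
    refine (setLIntegral_mono' hBm hpt).trans ?_
    rw [lintegral_add_left measurable_const, setLIntegral_const, hvB,
      lintegral_const_mul _ (measurable_gagInner n s Y hw),
      ENNReal.ofReal_add (by norm_num) (by positivity), ← ENNReal.ofReal_mul (by positivity)]
    have h4 : 1 / (3 * V) * V = 1 / 3 := by field_simp
    rw [h4]
    gcongr
    calc ENNReal.ofReal ((A + 1) / 3) * ∫⁻ x in B, gagInner n s Y.G w x
        ≤ ENNReal.ofReal ((A + 1) / 3) * 1 := by
          gcongr
          refine (setLIntegral_le_lintegral _ _).trans ?_
          rw [lintegral_gagInner n s Y hw]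
          exact hws
      _ = _ := mul_one _
  have hA1 : A ≤ 1 := by
    rw [hIA, ENNReal.ofReal_le_ofReal_iff (by positivity)] at hIle
    linarith
  calc ∫⁻ x in Ω, ENNReal.ofReal (H (w x / Λ)) ≤ I := lintegral_mono_set hΩR
    _ = ENNReal.ofReal A := hIA
    _ ≤ 1 := by rw [← ENNReal.ofReal_one]; exact ENNReal.ofReal_le_ofReal hA1

lemma modsG_mono {n : ℕ} {s : ℝ} (Y : YoungPair) {v w : Euc n → ℝ}
    (h : ∀ x y, |v x - v y| ≤ |w x - w y|) : modsG n s Y.G v ≤ modsG n s Y.G w := by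
  refine lintegral_mono fun p => ENNReal.ofReal_le_ofReal ?_
  refine div_le_div_of_nonneg_right ?_ (rpow_nonneg (norm_nonneg _) _)
  refine Y.G_monotoneOn (mem_Ici.2 (abs_nonneg _)) (mem_Ici.2 (abs_nonneg _)) ?_
  unfold Ds
  rw [abs_div, abs_div]
  exact div_le_div_of_nonneg_right (h _ _) (abs_nonneg _)

lemma modular_le_one_of_forall_truncation {α : Type*} [MeasurableSpace α] {μ : Measure α}
    {H : ℝ → ℝ} (hH : MonotoneOn H (Ici 0)) {f : α → ℝ} (hf : Measurable f)
    (hf0 : ∀ x, 0 ≤ f x) {Λ : ℝ} (hΛ : 0 < Λ)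
    (h : ∀ k : ℕ, ∫⁻ x, ENNReal.ofReal (H (min (f x) k / Λ)) ∂μ ≤ 1) :
    ∫⁻ x, ENNReal.ofReal (H (f x / Λ)) ∂μ ≤ 1 := by
  have hk0 : ∀ (k : ℕ) x, 0 ≤ min (f x) k / Λ := fun k x =>
    div_nonneg (le_min (hf0 x) k.cast_nonneg) hΛ.le
  have hle : ∀ x, ENNReal.ofReal (H (f x / Λ)) ≤
      ⨆ k : ℕ, ENNReal.ofReal (H (min (f x) k / Λ)) := by
    intro x
    obtain ⟨k, hk⟩ := exists_nat_ge (f x)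
    refine le_trans ?_ (le_iSup _ k)
    rw [min_eq_left hk]
  refine (lintegral_mono hle).trans ?_
  rw [lintegral_iSup]
  · exact iSup_le h
  · intro k
    exact (measurable_comp_of_monotoneOn hH ((hf.min measurable_const).div_const Λ)
      (hk0 k)).ennreal_ofReal
  · intro j k hjk x
    have : min (f x) j / Λ ≤ min (f x) k / Λ := by gcongr
    exact ENNReal.ofReal_le_ofReal (hH (hk0 j x) (hk0 k x) this)

lemma exists_modular_le_one {n : ℕ} (hn : 1 ≤ n) {s : ℝ} (hs : 0 < s)
    {pm pp : ℝ} (hspp : s * pp < n) {Ω : Set (Euc n)} (hΩ : MeasurableSet Ω)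
    (hΩb : Bornology.IsBounded Ω) {Y : YoungPair} (hY : Y.Cond pm pp)
    {Ginv H : ℝ → ℝ} (hGinv : ∀ t : ℝ, 0 ≤ t → 0 ≤ Ginv t ∧ Y.G (Ginv t) = t)
    (hH : IsCritical Ginv H (s / n)) :
    ∃ Λ : ℝ, 0 < Λ ∧ ∀ u : Euc n → ℝ, Measurable u →
      ∫⁻ x in Ω, ENNReal.ofReal (Y.G |u x|) ≤ 1 → modsG n s Y.G u ≤ 1 →
      ∫⁻ x in Ω, ENNReal.ofReal (H (|u x| / Λ)) ≤ 1 := by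
  by_cases hΩ0 : volume Ω = 0
  · exact ⟨1, one_pos, fun u _ _ _ => by simp [Measure.restrict_eq_zero.2 hΩ0]⟩
  obtain ⟨Λ, hΛ, h⟩ := exists_modular_le_one_of_bounded hn hs hspp hΩ hΩ0 hΩb hY hGinv hH
  refine ⟨Λ, hΛ, fun u hu hu1 hu2 => ?_⟩
  have hua : Measurable fun x => |u x| := by fun_prop
  refine modular_le_one_of_forall_truncation hH.monotoneOn hua (fun x => abs_nonneg _) hΛ
    fun k => ?_
  have h0 : ∀ x, 0 ≤ min |u x| k := fun x => le_min (abs_nonneg _) k.cast_nonneg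
  refine h (fun x => min |u x| k) (hua.min measurable_const) h0
    ⟨k, fun x => min_le_right _ _⟩ ?_ ?_
  · refine le_trans (lintegral_mono fun x => ENNReal.ofReal_le_ofReal ?_) hu1
    exact Y.G_monotoneOn (h0 x) (mem_Ici.2 (abs_nonneg _)) (min_le_left _ _)
  · refine (modsG_mono Y fun x y => ?_).trans hu2
    refine (abs_min_sub_min_le_max _ _ _ _).trans ?_
    rw [sub_self, abs_zero, max_eq_left (abs_nonneg _)]
    exact abs_abs_sub_abs_le_abs_sub _ _

lemma modular_le_one_of_luxNorm_lt {n : ℕ} (Y : YoungPair) {Ω : Set (Euc n)} {u : Euc n → ℝ}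
    {l : ℝ≥0∞} (hl : luxNorm n Y.G Ω u < l) (hlt : l ≠ ⊤) :
    ∫⁻ x in Ω, ENNReal.ofReal (Y.G (|u x| / l.toReal)) ≤ 1 := by
  obtain ⟨a, ⟨ha0, hat, ha⟩, hal⟩ := sInf_lt_iff.1 hl
  refine le_trans (lintegral_mono fun x => ENNReal.ofReal_le_ofReal ?_) ha
  have h0 : 0 < a.toReal := ENNReal.toReal_pos ha0.ne' hat
  have h1 : a.toReal ≤ l.toReal := ENNReal.toReal_mono hlt hal.le
  have h2 : |u x| / l.toReal ≤ |u x| / a.toReal :=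
    div_le_div_of_nonneg_left (abs_nonneg _) h0 h1
  exact Y.G_monotoneOn (mem_Ici.2 (by positivity)) (mem_Ici.2 (by positivity)) h2

lemma modsG_le_one_of_gagSemi_lt {n : ℕ} {s : ℝ} (Y : YoungPair) {u : Euc n → ℝ}
    {l : ℝ≥0∞} (hl : gagSemi n s Y.G u < l) (hlt : l ≠ ⊤) :
    modsG n s Y.G (fun x => u x / l.toReal) ≤ 1 := by
  obtain ⟨a, ⟨ha0, hat, ha⟩, hal⟩ := sInf_lt_iff.1 hl
  refine le_trans (modsG_mono Y fun x y => ?_) ha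
  have h0 : 0 < a.toReal := ENNReal.toReal_pos ha0.ne' hat
  have h1 : a.toReal ≤ l.toReal := ENNReal.toReal_mono hlt hal.le
  rw [← sub_div, ← sub_div, abs_div, abs_div, abs_of_pos h0, abs_of_pos (h0.trans_le h1)]
  exact div_le_div_of_nonneg_left (abs_nonneg _) h0 h1

/-- Orlicz–Sobolev embedding `‖u‖_{L^{G*}(Ω)} ≤ C ‖u‖_{s,G}`. -/
theorem statement3 (n : ℕ) (hn : 1 ≤ n) (s : ℝ) (hs : s ∈ Set.Ioo (0 : ℝ) 1)
    (pm pp : ℝ) (hpm : 1 < pm) (hpmpp : pm ≤ pp) (hspp : s * pp < n)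
    (Ω : Set (Euc n)) (hΩo : IsOpen Ω) (hΩb : Bornology.IsBounded Ω)
    (Y : YoungPair) (hY : Y.Cond pm pp)
    (Ginv Gstar : ℝ → ℝ)
    (hGinv : ∀ t : ℝ, 0 ≤ t → 0 ≤ Ginv t ∧ Y.G (Ginv t) = t)
    (hGinv' : ∀ t : ℝ, 0 ≤ t → Ginv (Y.G t) = t)
    (hGstar : ∀ r : ℝ, 0 ≤ r →
      Gstar (∫ τ in (0 : ℝ)..r, Ginv τ * τ ^ (-((n : ℝ) + s) / n)) = r)
    (hGstar' : ∀ t : ℝ, 0 ≤ t → 0 ≤ Gstar t ∧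
      (∫ τ in (0 : ℝ)..(Gstar t), Ginv τ * τ ^ (-((n : ℝ) + s) / n)) = t) :
    ∃ C : ℝ, 0 < C ∧
      ∀ u : Euc n → ℝ, Measurable u →
        luxNorm n Y.G Ω u + gagSemi n s Y.G u < ⊤ →
        luxNorm n Gstar Ω u ≤
          ENNReal.ofReal C * (luxNorm n Y.G Ω u + gagSemi n s Y.G u) := by
  have hn0 : (0 : ℝ) < n := by exact_mod_cast hn
  have hpp : 0 < pp := by linarith
  have hexp : -((n : ℝ) + s) / n = -1 - s / n := by field_simp; ring
  rw [hexp] at hGstar hGstar'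
  have hcrit : IsCritical Ginv Gstar (s / n) :=
    isCritical_of_inverse (s / n) (div_pos hs.1 hn0) hpp
      (by rw [div_mul_eq_mul_div, div_lt_one hn0]; exact hspp) Y hY hGinv hGinv' hGstar hGstar'
  obtain ⟨Λ, hΛ, h⟩ := exists_modular_le_one hn hs.1 hspp hΩo.measurableSet hΩb hY hGinv hcrit
  refine ⟨Λ, hΛ, fun u hu _ => ?_⟩
  rw [mul_comm, ← ENNReal.div_le_iff_le_mul (Or.inl (ENNReal.ofReal_pos.2 hΛ).ne')
    (Or.inl ENNReal.ofReal_ne_top)]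
  refine le_of_forall_gt_imp_ge_of_dense fun l hl => ?_
  rcases eq_or_ne l ⊤ with rfl | hlt
  · exact le_top
  have hl0 : 0 < l := bot_le.trans_lt hl
  have hl0' : 0 < l.toReal := ENNReal.toReal_pos hl0.ne' hlt
  have h1 := modular_le_one_of_luxNorm_lt Y (le_self_add.trans_lt hl) hlt
  have h2 := modsG_le_one_of_gagSemi_lt Y (le_add_self.trans_lt hl) hlt
  have h3 := h (fun x => u x / l.toReal) (hu.div_const _)
    (by simpa only [abs_div, abs_of_pos hl0'] using h1) h2
  rw [ENNReal.div_le_iff_le_mul (Or.inl (ENNReal.ofReal_pos.2 hΛ).ne')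
    (Or.inl ENNReal.ofReal_ne_top)]
  refine sInf_le ⟨ENNReal.mul_pos hl0.ne' (ENNReal.ofReal_pos.2 hΛ).ne',
    ENNReal.mul_ne_top hlt ENNReal.ofReal_ne_top, ?_⟩
  simpa only [abs_div, abs_of_pos hl0', div_div, ENNReal.toReal_mul,
    ENNReal.toReal_ofReal hΛ.le] using h3

end
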